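/- (Paper's equation (DQ) in the flat model: D acts tangentially to the null cone.) Let f be a smooth function on ℝ^N ∖ {0} homogeneous of weight w ∈ ℝ. Then for every index A ∈ Fin N, (D^{(w+2)}(Q · f))_A = Q · ((D^{(w)} f)_A + 4 ∂_A f) on ℝ^N ∖ {0}. (Here Q · f is homogeneous of weight w + 2, so the operator D is taken at weight w + 2 on the left-hand side.) -/

import Mathlib

open scoped BigOperators

/-- Partial derivative in the `A`-th coordinate direction. -/
noncomputable def pd {N : ℕ} (A : Fin N) (f : (Fin N → ℝ) → ℝ) : (Fin N → ℝ) → ℝ :=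
  fun x => fderiv ℝ f x (Pi.single A 1)

/-- Ambient Laplacian `Δf = ∑_{A,B} h^{AB} ∂_A ∂_B f` w.r.t. the inverse metric `hInv`. -/
noncomputable def lap {N : ℕ} (hInv : Matrix (Fin N) (Fin N) ℝ)
    (f : (Fin N → ℝ) → ℝ) : (Fin N → ℝ) → ℝ :=
  fun x => ∑ A : Fin N, ∑ B : Fin N, hInv A B * pd A (pd B f) x

/-- `X_A(x) = ∑_B h_{AB} x^B`. -/
def Xc {N : ℕ} (h : Matrix (Fin N) (Fin N) ℝ) (A : Fin N) : (Fin N → ℝ) → ℝ :=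
  fun x => ∑ B : Fin N, h A B * x B

/-- `Q(x) = ∑_{A,B} h_{AB} x^A x^B`. -/
def Qfun {N : ℕ} (h : Matrix (Fin N) (Fin N) ℝ) : (Fin N → ℝ) → ℝ :=
  fun x => ∑ A : Fin N, ∑ B : Fin N, h A B * x A * x B

/-- Smooth (C^∞) on `ℝ^N ∖ {0}`. -/
def SmoothOffZero {N : ℕ} (f : (Fin N → ℝ) → ℝ) : Prop :=
  ContDiffOn ℝ (⊤ : ℕ∞) f {x : Fin N → ℝ | x ≠ 0}

/-- Homogeneous of weight `w` on `ℝ^N ∖ {0}`. -/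
def Homog {N : ℕ} (w : ℝ) (f : (Fin N → ℝ) → ℝ) : Prop :=
  ∀ x : Fin N → ℝ, x ≠ 0 → (∑ A : Fin N, x A * pd A f x) = w * f x

/-- Ambient tractor-D operator at weight `w`: `(D^{(w)} f)_A = (n+2w−2)∂_A f − X_A Δf`. -/
noncomputable def Dop {N : ℕ} (n : ℕ) (h hInv : Matrix (Fin N) (Fin N) ℝ) (w : ℝ)
    (f : (Fin N → ℝ) → ℝ) (A : Fin N) : (Fin N → ℝ) → ℝ :=
  fun x => ((n : ℝ) + 2 * w - 2) * pd A f x - Xc h A x * lap hInv f x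

/-- Iterated tractor-D: `seqD … w0 f A 0 = f` and
`seqD … w0 f A (j+1) = (D^{(w0−j)} (seqD … w0 f A j))_{A (j+1)}`. -/
noncomputable def seqD {N : ℕ} (n : ℕ) (h hInv : Matrix (Fin N) (Fin N) ℝ)
    (w0 : ℝ) (f : (Fin N → ℝ) → ℝ) (A : ℕ → Fin N) : ℕ → (Fin N → ℝ) → ℝ
  | 0 => f
  | j + 1 => Dop n h hInv (w0 - (j : ℝ)) (seqD n h hInv w0 f A j) (A (j + 1))

/-- `u` is `O(Q^m)`: `u = Q^m · g` for some smooth `g` on `ℝ^N ∖ {0}`. -/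
def BigOQ {N : ℕ} (h : Matrix (Fin N) (Fin N) ℝ) (m : ℕ) (u : (Fin N → ℝ) → ℝ) : Prop :=
  ∃ g : (Fin N → ℝ) → ℝ, SmoothOffZero g ∧
    ∀ x : Fin N → ℝ, x ≠ 0 → u x = (Qfun h x) ^ m * g x

theorem hasFDerivAt_Xc {N : ℕ} (h : Matrix (Fin N) (Fin N) ℝ) (A : Fin N) (x : Fin N → ℝ) :
    HasFDerivAt (Xc h A)
      (∑ B, h A B • ContinuousLinearMap.proj (R := ℝ) (φ := fun _ : Fin N => ℝ) B) x :=
  HasFDerivAt.fun_sum fun B _ => (hasFDerivAt_apply B x).const_mul (h A B)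

theorem pd_Xc {N : ℕ} (h : Matrix (Fin N) (Fin N) ℝ) (A B : Fin N) (x : Fin N → ℝ) :
    pd A (Xc h B) x = h B A := by
  simp [pd, (hasFDerivAt_Xc h B x).fderiv, Pi.single_apply]

theorem pd_mul {N : ℕ} (A : Fin N) {f g : (Fin N → ℝ) → ℝ} {x : Fin N → ℝ}
    (hf : DifferentiableAt ℝ f x) (hg : DifferentiableAt ℝ g x) :
    pd A (fun y => f y * g y) x = f x * pd A g x + pd A f x * g x := by
  simp [pd, fderiv_fun_mul hf hg, mul_comm]

theorem Qfun_eq_sum_Xc {N : ℕ} (h : Matrix (Fin N) (Fin N) ℝ) :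
    Qfun h = fun x => ∑ A, x A * Xc h A x := by
  funext x
  simp only [Qfun, Xc, Finset.mul_sum]
  exact Finset.sum_congr rfl fun _ _ => Finset.sum_congr rfl fun _ _ => by ring

theorem hasFDerivAt_Qfun {N : ℕ} (h : Matrix (Fin N) (Fin N) ℝ) (x : Fin N → ℝ) :
    HasFDerivAt (Qfun h)
      (∑ B, (x B • (∑ C, h B C • ContinuousLinearMap.proj (R := ℝ) (φ := fun _ : Fin N => ℝ) C) +
        Xc h B x • ContinuousLinearMap.proj (R := ℝ) (φ := fun _ : Fin N => ℝ) B)) x := by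
  rw [Qfun_eq_sum_Xc]
  exact HasFDerivAt.fun_sum fun B _ => (hasFDerivAt_apply B x).mul (hasFDerivAt_Xc h B x)

theorem pd_Qfun {N : ℕ} {h : Matrix (Fin N) (Fin N) ℝ} (hSymm : ∀ A B, h A B = h B A) (A : Fin N) :
    pd A (Qfun h) = fun x => 2 * Xc h A x := by
  funext x
  have hX : ∑ B, x B * h B A = Xc h A x :=
    Finset.sum_congr rfl fun B _ => by rw [hSymm B A, mul_comm]
  simp [pd, (hasFDerivAt_Qfun h x).fderiv, Pi.single_apply, Finset.sum_add_distrib, hX, two_mul]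

theorem SmoothOffZero.contDiffAt {N : ℕ} {f : (Fin N → ℝ) → ℝ} (hf : SmoothOffZero f)
    {x : Fin N → ℝ} (hx : x ≠ 0) : ContDiffAt ℝ (⊤ : ℕ∞) f x :=
  ContDiffOn.contDiffAt hf (isOpen_ne.mem_nhds hx)

theorem SmoothOffZero.differentiableAt {N : ℕ} {f : (Fin N → ℝ) → ℝ} (hf : SmoothOffZero f)
    {x : Fin N → ℝ} (hx : x ≠ 0) : DifferentiableAt ℝ f x :=
  (hf.contDiffAt hx).differentiableAt (by simp)

theorem SmoothOffZero.pd {N : ℕ} {f : (Fin N → ℝ) → ℝ} (hf : SmoothOffZero f) (A : Fin N) :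
    SmoothOffZero (pd A f) := fun _ hx =>
  (((hf.contDiffAt hx).fderiv_right (m := (⊤ : ℕ∞)) (by simp)).clm_apply
    contDiffAt_const).contDiffWithinAt

theorem pd_pd_Qfun_mul {N : ℕ} {h : Matrix (Fin N) (Fin N) ℝ} (hSymm : ∀ A B, h A B = h B A)
    {f : (Fin N → ℝ) → ℝ} (hf : SmoothOffZero f) (A B : Fin N) {x : Fin N → ℝ} (hx : x ≠ 0) :
    pd A (pd B (fun y => Qfun h y * f y)) x =
      Qfun h x * pd A (pd B f) x + 2 * Xc h A x * pd B f x + 2 * Xc h B x * pd A f x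
        + 2 * h B A * f x := by
  have hQ (y) : DifferentiableAt ℝ (Qfun h) y := (hasFDerivAt_Qfun h y).differentiableAt
  have hX (y) : DifferentiableAt ℝ (Xc h B) y := (hasFDerivAt_Xc h B y).differentiableAt
  have hfx := hf.differentiableAt hx
  have hpf := (hf.pd B).differentiableAt hx
  have heq : pd B (fun y => Qfun h y * f y) =ᶠ[nhds x]
      fun y => Qfun h y * pd B f y + 2 * (Xc h B y * f y) := by
    filter_upwards [isOpen_ne.mem_nhds hx] with y hy
    rw [pd_mul B (hQ y) (hf.differentiableAt hy), pd_Qfun hSymm, mul_assoc]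
  have hadd : pd A (fun y => Qfun h y * pd B f y + 2 * (Xc h B y * f y)) x =
      pd A (fun y => Qfun h y * pd B f y) x + 2 * pd A (fun y => Xc h B y * f y) x := by
    have hd := ((hX x).fun_mul hfx)
    change fderiv ℝ _ x _ = fderiv ℝ _ x _ + 2 * fderiv ℝ _ x _
    rw [fderiv_fun_add ((hQ x).fun_mul hpf) (hd.const_mul 2), fderiv_const_mul hd]
    simp
  have hcongr : pd A (pd B (fun y => Qfun h y * f y)) x =
      pd A (fun y => Qfun h y * pd B f y + 2 * (Xc h B y * f y)) x :=
    congrArg (fun L : (Fin N → ℝ) →L[ℝ] ℝ => L (Pi.single A 1)) heq.fderiv_eq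
  rw [hcongr, hadd, pd_mul A (hQ x) hpf, pd_mul A (hX x) hfx, pd_Qfun hSymm, pd_Xc]
  ring

theorem sum_hInv_mul_Xc {N : ℕ} {h hInv : Matrix (Fin N) (Fin N) ℝ} (hinv : hInv * h = 1)
    (A : Fin N) (x : Fin N → ℝ) : ∑ B, hInv A B * Xc h B x = x A := by
  change (hInv.mulVec (h.mulVec x)) A = x A
  rw [Matrix.mulVec_mulVec, hinv, Matrix.one_mulVec]

theorem lap_Qfun_mul {N : ℕ} {h hInv : Matrix (Fin N) (Fin N) ℝ} (hSymm : ∀ A B, h A B = h B A)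
    (hInvh : h * hInv = 1) {f : (Fin N → ℝ) → ℝ} (hf : SmoothOffZero f)
    {x : Fin N → ℝ} (hx : x ≠ 0) :
    lap hInv (fun y => Qfun h y * f y) x =
      Qfun h x * lap hInv f x + 4 * ∑ A, x A * pd A f x + 2 * N * f x := by
  have hinv : hInv * h = 1 := mul_eq_one_comm.mp hInvh
  have hT : h.transpose = h := Matrix.ext fun A B => hSymm B A
  have hinvT : hInv.transpose * h = 1 := by
    rw [← hT, ← Matrix.transpose_mul, hInvh, Matrix.transpose_one]
  have h₁ : ∑ A, ∑ B, hInv A B * (2 * Xc h B x * pd A f x) = 2 * ∑ A, x A * pd A f x := by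
    rw [Finset.mul_sum]
    refine Finset.sum_congr rfl fun A _ => ?_
    rw [← sum_hInv_mul_Xc hinv A x, Finset.sum_mul, Finset.mul_sum]
    exact Finset.sum_congr rfl fun B _ => by ring
  have h₂ : ∑ A, ∑ B, hInv A B * (2 * Xc h A x * pd B f x) = 2 * ∑ B, x B * pd B f x := by
    rw [Finset.sum_comm, Finset.mul_sum]
    refine Finset.sum_congr rfl fun B _ => ?_
    rw [← sum_hInv_mul_Xc hinvT B x, Finset.sum_mul, Finset.mul_sum]
    exact Finset.sum_congr rfl fun A _ => by rw [Matrix.transpose_apply]; ring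
  have h₃ : ∑ A, ∑ B, hInv A B * (2 * h B A * f x) = 2 * N * f x := by
    have htr : ∑ A, ∑ B, hInv A B * h B A = N := by
      have := congrArg Matrix.trace hinv
      simpa [Matrix.trace, Matrix.mul_apply] using this
    rw [← htr, Finset.mul_sum, Finset.sum_mul]
    refine Finset.sum_congr rfl fun A _ => ?_
    rw [Finset.mul_sum, Finset.sum_mul]
    exact Finset.sum_congr rfl fun B _ => by ring
  have h₄ : ∑ A, ∑ B, hInv A B * (Qfun h x * pd A (pd B f) x) = Qfun h x * lap hInv f x := by
    simp only [lap, Finset.mul_sum]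
    exact Finset.sum_congr rfl fun A _ => Finset.sum_congr rfl fun B _ => by ring
  simp only [lap, pd_pd_Qfun_mul hSymm hf _ _ hx, mul_add, Finset.sum_add_distrib] at h₄ ⊢
  rw [h₁, h₂, h₃, h₄]
  ring

/-- equation (DQ): for `f` homogeneous of weight `w`,
`(D^{(w+2)}(Q·f))_A = Q·((D^{(w)} f)_A + 4 ∂_A f)` on `ℝ^N ∖ {0}`. -/
theorem Dop_Q_commutator
    (n : ℕ) (hn : 1 ≤ n)
    (h hInv : Matrix (Fin (n + 2)) (Fin (n + 2)) ℝ)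
    (hSymm : ∀ A B, h A B = h B A) (hInvh : h * hInv = 1)
    (w : ℝ) (f : (Fin (n + 2) → ℝ) → ℝ) (hf : SmoothOffZero f) (hhom : Homog w f)
    (A : Fin (n + 2)) :
    ∀ x : Fin (n + 2) → ℝ, x ≠ 0 →
      Dop n h hInv (w + 2) (fun y => Qfun h y * f y) A x
        = Qfun h x * (Dop n h hInv w f A x + 4 * pd A f x) := by
  intro x hx
  have hQ : DifferentiableAt ℝ (Qfun h) x := (hasFDerivAt_Qfun h x).differentiableAt
  simp only [Dop]
  rw [lap_Qfun_mul hSymm hInvh hf hx, hhom x hx, pd_mul A hQ (hf.differentiableAt hx),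
    pd_Qfun hSymm]
  push_cast
  ring
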